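/- Let p be a prime, k ≥ 1, and let G be a cyclic group of order p^k with fixed generator τ. Let R be a commutative ring containing an element ζ that is a root of the p^k-th cyclotomic polynomial over ℤ, and let M be a finite R[G]-module. Let H = ⟨τ^{p^{k-1}}⟩ be the unique subgroup of G of order p, and set ξ = ζ^{p^{k-1}}. Assume that for every 0 ≤ l ≤ p-1, {m ∈ M : τ^{p^{k-1}}·m = ξ^l·m} = (Σ_{j=0}^{p-1} ξ^{-lj} τ^{j p^{k-1}})·M (i.e., Ĥ⁰_χ(H,M) = 0 for every R-valued character χ of H). Then for every 0 ≤ i ≤ p^k − 1 one has M^{χ^i} = ε_{χ^i}M (i.e., Ĥ⁰_{χ^i}(G,M) = 0), and [M] = ∏_{i=0}^{p^k-1} [M^{χ^i}] = ∏_{i=0}^{p^k-1} [ε_{χ^i}M]. -/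

import Mathlib

noncomputable section

open Polynomial

variable {R : Type*} [CommRing R] {M : Type*} [AddCommGroup M] [Module R M]

/-- The isotypic component `M^{χ^i} = {m : τ m = ζ^i m}` of the module `M`, where the
generator `τ` of the cyclic group acts via the `R`-linear endomorphism `T` and
`ζ` is the chosen root of unity. -/
def isoComp (T : Module.End R M) (ζ : R) (i : ℕ) : Submodule R M :=
  LinearMap.ker (T - ζ ^ i • (1 : Module.End R M))

/-- The quasi-idempotent `ε_{χ^i} = ∑_{j<n} ζ^{-ij} τ^j`, acting on `M`.  Here
`ζ⁻¹ = ζ^{n-1}` since `ζ^n = 1`. -/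
def quasiIdem (T : Module.End R M) (ζ : R) (n i : ℕ) : Module.End R M :=
  ∑ j ∈ Finset.range n, ζ ^ ((n - 1) * (i * j)) • T ^ j

/-- The product `P_i = ∏_{j=i+1}^{n-1} (τ - ζ^j)`, acting on `M`. -/
def tailProd (T : Module.End R M) (ζ : R) (n i : ℕ) : Module.End R M :=
  Polynomial.aeval T (∏ j ∈ Finset.Ico (i + 1) n, (X - C (ζ ^ j)))

/-- `Ĥ⁰_{χ^i}(G, M) = M^{χ^i} / ε_{χ^i} M`. -/
abbrev H0chi (T : Module.End R M) (ζ : R) (n i : ℕ) :=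
  ↥(isoComp T ζ i) ⧸
    Submodule.comap (isoComp T ζ i).subtype (LinearMap.range (quasiIdem T ζ n i))

/-- `S_{χ^i}(M) = (M^{χ^i} ∩ P_i M) / ε_{χ^i} M`, a submodule of `Ĥ⁰_{χ^i}(G, M)`. -/
def Schi (T : Module.End R M) (ζ : R) (n i : ℕ) : Submodule R (H0chi T ζ n i) :=
  Submodule.map
    (Submodule.mkQ
      (Submodule.comap (isoComp T ζ i).subtype (LinearMap.range (quasiIdem T ζ n i))))
    (Submodule.comap (isoComp T ζ i).subtype (LinearMap.range (tailProd T ζ n i)))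

/-- Rank–nullity for cardinalities of an endomorphism restricted to a submodule. -/
lemma card_eq_card_ker_mul_card_map (A : Module.End R M) (N : Submodule R M)
    (h : LinearMap.ker A ≤ N) :
    Nat.card N = Nat.card (LinearMap.ker A) * Nat.card (N.map A) := by
  have h₁ := Submodule.card_eq_card_quotient_mul_card (LinearMap.ker (A.domRestrict N))
  rw [Nat.card_congr (A.domRestrict N).quotKerEquivRange.toEquiv, LinearMap.range_domRestrict]
    at h₁
  have h₂ : Nat.card (LinearMap.ker (A.domRestrict N)) = Nat.card (LinearMap.ker A) := by
    rw [LinearMap.ker_domRestrict]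
    exact Nat.card_congr (Submodule.comapSubtypeEquivOfLe h).toEquiv
  rw [h₁, h₂, mul_comm]

lemma card_eq_card_ker_mul_card_range (A : Module.End R M) :
    Nat.card M = Nat.card (LinearMap.ker A) * Nat.card (LinearMap.range A) := by
  rw [Submodule.card_eq_card_quotient_mul_card (LinearMap.ker A),
    Nat.card_congr A.quotKerEquivRange.toEquiv]

/-- On a finite module, exactness of the periodic complex with differentials `A` and `B` at one
spot implies exactness at the other. -/
lemma ker_eq_range_of_ker_eq_range [Finite M] {A B : Module.End R M} (hBA : B * A = 0)
    (h : LinearMap.ker A = LinearMap.range B) : LinearMap.ker B = LinearMap.range A := by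
  have hle : LinearMap.range A ≤ LinearMap.ker B := by
    rintro _ ⟨x, rfl⟩
    exact LinearMap.congr_fun hBA x
  have hcard : Nat.card (LinearMap.ker B) = Nat.card (LinearMap.range A) := by
    have hA := card_eq_card_ker_mul_card_range A
    have hB := card_eq_card_ker_mul_card_range B
    rw [h, hB, mul_comm] at hA
    exact Nat.eq_of_mul_eq_mul_left Nat.card_pos hA
  refine (SetLike.coe_injective ?_).symm
  exact Set.eq_of_subset_of_ncard_le hle hcard.le (Set.toFinite _)

lemma geom_sum_pow_mul_geom_sum {S : Type*} [Semiring S] (x : S) (p q : ℕ) :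
    (∑ j ∈ Finset.range p, (x ^ q) ^ j) * ∑ j ∈ Finset.range q, x ^ j =
      ∑ j ∈ Finset.range (p * q), x ^ j := by
  induction p with
  | zero => simp
  | succ p ih =>
    rw [Finset.sum_range_succ, add_mul, ih, add_mul, one_mul, Finset.sum_range_add, Finset.mul_sum]
    simp only [← pow_mul, ← pow_add, mul_comm q p]

/-- If the zeroth Tate cohomology of a finite module vanishes for the subgroup of order `p` of a
cyclic `p`-group, then it vanishes for the whole group. -/
lemma ker_sub_one_eq_range_geom_sum [Finite M] (p q k : ℕ) (hpq : p * q = p ^ k)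
    (T : Module.End R M) (hT : T ^ (p * q) = 1)
    (hH : LinearMap.ker (T ^ q - 1) = LinearMap.range (∑ j ∈ Finset.range p, (T ^ q) ^ j)) :
    LinearMap.ker (T - 1) = LinearMap.range (∑ j ∈ Finset.range (p * q), T ^ j) := by
  set E := ∑ j ∈ Finset.range (p * q), T ^ j with hE
  have hker : ∀ m ∈ LinearMap.ker (T - 1), T m = m := fun m hm ↦ by
    simpa [sub_eq_zero] using hm
  have hpow : ∀ m, T m = m → ∀ j : ℕ, (T ^ j) m = m := fun m hm j ↦ by
    rw [Module.End.pow_apply]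
    exact Function.iterate_fixed hm j
  have hfac : (∑ j ∈ Finset.range p, (T ^ q) ^ j) * (∑ j ∈ Finset.range q, T ^ j) = E := by
    rw [hE, geom_sum_pow_mul_geom_sum]
  have hexact : LinearMap.ker (∑ j ∈ Finset.range p, (T ^ q) ^ j) = LinearMap.range (T ^ q - 1) :=
    ker_eq_range_of_ker_eq_range
      (by rw [geom_sum_mul, ← pow_mul, mul_comm q p, hT, sub_self]) hH
  have step : ∀ m, T m = m → ∃ z w, T w = w ∧ m = E z + p • w := by
    intro m hm
    have hm' : m ∈ LinearMap.ker (T ^ q - 1) := by simp [hpow m hm q]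
    rw [hH] at hm'
    obtain ⟨y, rfl⟩ := hm'
    have hcomm : (∑ j ∈ Finset.range p, (T ^ q) ^ j) * T = T * ∑ j ∈ Finset.range p, (T ^ q) ^ j :=
      (Commute.sum_left _ _ _ fun j _ ↦ ((Commute.refl T).pow_left q).pow_left j).eq
    have hy : (T - 1) y ∈ LinearMap.ker (∑ j ∈ Finset.range p, (T ^ q) ^ j) := by
      have := LinearMap.congr_fun hcomm y
      simp only [Module.End.mul_apply] at this
      rw [LinearMap.mem_ker, LinearMap.sub_apply, map_sub, this, hm, Module.End.one_apply, sub_self]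
    rw [hexact] at hy
    obtain ⟨z, hz⟩ := hy
    have hw : T (y - (∑ j ∈ Finset.range q, T ^ j) z) = y - (∑ j ∈ Finset.range q, T ^ j) z := by
      have h := LinearMap.congr_fun (mul_geom_sum T q) z
      rw [hz, Module.End.mul_apply] at h
      simp only [LinearMap.sub_apply, Module.End.one_apply] at h
      rw [map_sub]
      rw [sub_eq_sub_iff_sub_eq_sub, h]
    refine ⟨z, _, hw, ?_⟩
    have hN : (∑ j ∈ Finset.range p, (T ^ q) ^ j) (y - (∑ j ∈ Finset.range q, T ^ j) z) =
        p • (y - (∑ j ∈ Finset.range q, T ^ j) z) := by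
      have hj : ∀ j ∈ Finset.range p, ((T ^ q) ^ j) (y - (∑ j ∈ Finset.range q, T ^ j) z) =
          y - (∑ j ∈ Finset.range q, T ^ j) z := fun j _ ↦ by
        rw [← pow_mul]
        exact hpow _ hw (q * j)
      rw [LinearMap.sum_apply, Finset.sum_congr rfl hj, Finset.sum_const, Finset.card_range]
    rw [← hN, ← hfac, Module.End.mul_apply, ← map_add, add_sub_cancel]
  have iter : ∀ r : ℕ, ∀ m, T m = m → ∃ z w, T w = w ∧ m = E z + p ^ r • w := by
    intro r
    induction r with
    | zero => exact fun m hm ↦ ⟨0, m, hm, by simp⟩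
    | succ r ih =>
      intro m hm
      obtain ⟨z, w, hw, rfl⟩ := ih m hm
      obtain ⟨z₁, w₁, hw₁, rfl⟩ := step w hw
      refine ⟨z + p ^ r • z₁, w₁, hw₁, ?_⟩
      rw [map_add, map_nsmul, smul_add, smul_smul, pow_succ, add_assoc]
  apply le_antisymm
  · intro m hm
    obtain ⟨z, w, hw, rfl⟩ := iter k m (hker m hm)
    refine ⟨z + w, ?_⟩
    have : E w = p ^ k • w := by
      rw [hE, LinearMap.sum_apply, Finset.sum_congr rfl fun j _ ↦ hpow _ hw j]
      simp [hpq]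
    rw [map_add, this]
  · rintro _ ⟨x, rfl⟩
    have h := LinearMap.congr_fun (mul_geom_sum T (p * q)) x
    rwa [hT, sub_self] at h

/-- `X ^ n - 1` splits over any commutative ring containing a root of `Φ_n`. -/
lemma prod_X_sub_C_pow_eq_X_pow_sub_one {n : ℕ} (hn : 0 < n) (ζ : R)
    (hζ : aeval ζ (cyclotomic n ℤ) = 0) :
    ∏ i ∈ Finset.range n, (X - C (ζ ^ i)) = (X ^ n - 1 : R[X]) := by
  set G : ℤ[X][X] := ∏ i ∈ Finset.range n, (X - C (X ^ i)) - (X ^ n - 1) with hG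
  have hθ := Complex.isPrimitiveRoot_exp n hn.ne'
  set θ := Complex.exp (2 * Real.pi * Complex.I / n)
  have hzero : G.map (aeval (R := ℤ) θ).toRingHom = 0 := by
    have h := X_pow_sub_C_eq_prod hθ hn (one_pow n)
    simp only [map_one, mul_one, map_pow] at h
    simp [hG, Polynomial.map_prod, h]
  have hdvd : ∀ c, cyclotomic n ℤ ∣ G.coeff c := by
    intro c
    rw [cyclotomic_eq_minpoly hθ hn]
    refine minpoly.isIntegrallyClosed_dvd (hθ.isIntegral hn) ?_
    simpa using congr_arg (fun P ↦ P.coeff c) hzero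
  have hR : G.map (aeval (R := ℤ) ζ).toRingHom = 0 := by
    ext c
    obtain ⟨g, hg⟩ := hdvd c
    simp [hg, hζ]
  simpa [hG, Polynomial.map_prod, sub_eq_zero] using hR

/-- If a product of polynomials annihilates `T`, and the kernel of each factor lies in the range of
the product of the later ones, then the order of the module is the product of the orders of the
kernels. -/
lemma card_eq_prod_card_ker_aeval (T : Module.End R M) (f : ℕ → R[X]) (n : ℕ)
    (h₀ : aeval T (∏ j ∈ Finset.range n, f j) = 0)
    (h : ∀ i < n, LinearMap.ker (aeval T (f i)) ≤
      LinearMap.range (aeval T (∏ j ∈ Finset.Ico (i + 1) n, f j))) :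
    Nat.card M = ∏ i ∈ Finset.range n, Nat.card (LinearMap.ker (aeval T (f i))) := by
  have key : ∀ m ≤ n, Nat.card (LinearMap.range (aeval T (∏ j ∈ Finset.Ico m n, f j))) =
      ∏ i ∈ Finset.range m, Nat.card (LinearMap.ker (aeval T (f i))) := by
    intro m
    induction m with
    | zero =>
      intro _
      rw [← Finset.range_eq_Ico, h₀, LinearMap.range_zero]
      simp
    | succ m ih =>
      intro hm
      rw [card_eq_card_ker_mul_card_map _ _ (h m hm), ← LinearMap.range_comp,
        ← Module.End.mul_eq_comp, ← map_mul, ← Finset.prod_eq_prod_Ico_succ_bot hm, ih (by omega),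
        Finset.prod_range_succ, mul_comm]
  rw [← key n le_rfl]
  simp [Module.End.one_eq_id, LinearMap.range_id]

lemma aeval_X_sub_C_pow (T : Module.End R M) (ζ : R) (i : ℕ) :
    aeval T (X - C (ζ ^ i)) = T - ζ ^ i • (1 : Module.End R M) := by
  rw [map_sub, aeval_X, aeval_C, Algebra.algebraMap_eq_smul_one]

lemma pow_sub_one_mul_mul_pow_eq_one {ζ : R} {n : ℕ} (hn : 0 < n) (hζ : ζ ^ n = 1) (i : ℕ) :
    ζ ^ ((n - 1) * i) * ζ ^ i = 1 := by
  obtain ⟨n, rfl⟩ := Nat.exists_eq_succ_of_ne_zero hn.ne'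
  rw [← pow_add, Nat.succ_sub_one, ← Nat.succ_mul, pow_mul, hζ, one_pow]

lemma isoComp_eq_ker_smul_sub_one (T : Module.End R M) {ζ u : R} {i : ℕ} (hu : u * ζ ^ i = 1) :
    isoComp T ζ i = LinearMap.ker (u • T - 1) := by
  ext m
  simp only [isoComp, LinearMap.mem_ker, LinearMap.sub_apply, LinearMap.smul_apply,
    Module.End.one_apply, sub_eq_zero]
  constructor
  · intro h
    rw [h, smul_smul, hu, one_smul]
  · intro h
    rw [← one_smul R (T m), ← hu, mul_comm, mul_smul, h]

lemma quasiIdem_eq_geom_sum (T : Module.End R M) (ζ : R) (n i : ℕ) :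
    quasiIdem T ζ n i = ∑ j ∈ Finset.range n, (ζ ^ ((n - 1) * i) • T) ^ j := by
  simp only [quasiIdem, _root_.smul_pow, ← pow_mul, mul_assoc]

lemma range_quasiIdem_le_range_tailProd (T : Module.End R M) {ζ : R} {n i : ℕ} (hi : i < n)
    (hζ : ζ ^ n = 1) (hprod : ∏ j ∈ Finset.range n, (X - C (ζ ^ j)) = (X ^ n - 1 : R[X])) :
    LinearMap.range (quasiIdem T ζ n i) ≤ LinearMap.range (tailProd T ζ n i) := by
  set u := ζ ^ ((n - 1) * i) with hu_def
  have hu : u * ζ ^ i = 1 := pow_sub_one_mul_mul_pow_eq_one (by omega) hζ i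
  have hun : u ^ n = 1 := by rw [hu_def, ← pow_mul, mul_comm, pow_mul, hζ, one_pow]
  have hE : quasiIdem T ζ n i = aeval T (∑ j ∈ Finset.range n, (C u * X) ^ j) := by
    rw [quasiIdem_eq_geom_sum, map_sum]
    refine Finset.sum_congr rfl fun j _ ↦ ?_
    rw [map_pow, map_mul, aeval_C, aeval_X, ← Algebra.smul_def]
  have hlin : C u * X - 1 = C u * (X - C (ζ ^ i)) := by
    rw [mul_sub, ← C_mul, hu, C_1]
  have hgeom : (∑ j ∈ Finset.range n, (C u * X) ^ j) =
      (∏ j ∈ Finset.Ico (i + 1) n, (X - C (ζ ^ j))) *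
        (C (ζ ^ i) * ∏ j ∈ Finset.range i, (X - C (ζ ^ j))) := by
    refine (monic_X_sub_C (ζ ^ i)).isRegular.left ?_
    have h₁ := mul_geom_sum (C u * X) n
    rw [hlin, mul_pow, ← C_pow, hun, C_1, one_mul, ← hprod,
      ← Finset.prod_range_mul_prod_Ico _ hi.le, Finset.prod_eq_prod_Ico_succ_bot hi] at h₁
    have hC : C u * C (ζ ^ i) = 1 := by rw [← C_mul, hu, C_1]
    dsimp only
    linear_combination C (ζ ^ i) * h₁ -
      (X - C (ζ ^ i)) * (∑ j ∈ Finset.range n, (C u * X) ^ j) * hC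
  rw [hE, hgeom, map_mul, Module.End.mul_eq_comp]
  exact LinearMap.range_comp_le_range _ _

/-- **Theorem 4.10.** Let `G` be cyclic of order `p^k` (`p` prime, `k ≥ 1`) with generator `τ`
(encoded as `T` with `T^{p^k} = 1`), let `R` contain a root `ζ` of the `p^k`-th cyclotomic
polynomial, and let `M` be a finite `R[G]`-module.  Let `H = ⟨τ^{p^{k-1}}⟩` be the unique
subgroup of order `p` and `ξ = ζ^{p^{k-1}}`.  If `Ĥ⁰_χ(H,M) = 0` for all characters `χ` of
`H` (i.e. `{m : τ^{p^{k-1}} m = ξ^l m} = (∑_{j<p} ξ^{-lj} τ^{j p^{k-1}}) M` for all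
`l < p`), then `Ĥ⁰_{χ^i}(G,M) = 0` (i.e. `M^{χ^i} = ε_{χ^i} M`) for all `i < p^k`, and
`[M] = ∏_i [M^{χ^i}] = ∏_i [ε_{χ^i} M]`. -/
theorem order_eq_prod_isotypic_of_H0_subgroup_eq_zero
    (p : ℕ) (hp : p.Prime) (k : ℕ) (hk : 1 ≤ k) (R : Type*) [CommRing R] (ζ : R)
    (hζ : Polynomial.aeval ζ (Polynomial.cyclotomic (p ^ k) ℤ) = 0)
    (M : Type*) [AddCommGroup M] [Module R M] [Finite M]
    (T : Module.End R M) (hT : T ^ p ^ k = 1)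
    (hH : ∀ l < p,
      isoComp (T ^ p ^ (k - 1)) (ζ ^ p ^ (k - 1)) l =
        LinearMap.range (quasiIdem (T ^ p ^ (k - 1)) (ζ ^ p ^ (k - 1)) p l)) :
    (∀ i < p ^ k, isoComp T ζ i = LinearMap.range (quasiIdem T ζ (p ^ k) i)) ∧
      Nat.card M = ∏ i ∈ Finset.range (p ^ k), Nat.card (isoComp T ζ i) ∧
      Nat.card M =
        ∏ i ∈ Finset.range (p ^ k), Nat.card (LinearMap.range (quasiIdem T ζ (p ^ k) i)) := by
  obtain ⟨k, rfl⟩ := Nat.exists_eq_succ_of_ne_zero (by omega : k ≠ 0)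
  simp only [Nat.succ_eq_add_one, Nat.add_sub_cancel] at *
  set n := p ^ (k + 1) with hn
  set q := p ^ k
  have hn0 : 0 < n := pow_pos hp.pos _
  have hpq : p * q = n := (pow_succ' p k).symm
  have hprod := prod_X_sub_C_pow_eq_X_pow_sub_one hn0 ζ hζ
  have hζn : ζ ^ n = 1 := by
    obtain ⟨g, hg⟩ := cyclotomic.dvd_X_pow_sub_one n ℤ
    have := congr_arg (aeval ζ) hg
    rw [map_mul, hζ, zero_mul] at this
    simpa [sub_eq_zero] using this
  have hξ : (ζ ^ q) ^ p = 1 := by rw [← pow_mul, mul_comm, hpq, hζn]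
  have hiso : ∀ i < n, isoComp T ζ i = LinearMap.range (quasiIdem T ζ n i) := by
    intro i _
    have hu := pow_sub_one_mul_mul_pow_eq_one hn0 hζn i
    have hv := pow_sub_one_mul_mul_pow_eq_one hp.pos hξ (i % p)
    have huv : (ζ ^ ((n - 1) * i)) ^ q = (ζ ^ q) ^ ((p - 1) * (i % p)) := by
      have hu' : (ζ ^ ((n - 1) * i)) ^ q * (ζ ^ q) ^ (i % p) = 1 := by
        rw [← pow_eq_pow_mod i hξ, ← pow_mul ζ q, mul_comm q i, pow_mul ζ i, ← mul_pow, hu,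
          one_pow]
      linear_combination (ζ ^ q) ^ ((p - 1) * (i % p)) * hu' - (ζ ^ ((n - 1) * i)) ^ q * hv
    have hH' := hH (i % p) (Nat.mod_lt _ hp.pos)
    rw [isoComp_eq_ker_smul_sub_one _ hv, quasiIdem_eq_geom_sum, ← huv, ← _root_.smul_pow] at hH'
    rw [isoComp_eq_ker_smul_sub_one _ hu, quasiIdem_eq_geom_sum]
    have := ker_sub_one_eq_range_geom_sum p q (k + 1) hpq (ζ ^ ((n - 1) * i) • T)
      (by rw [hpq, _root_.smul_pow, hT, ← pow_mul, mul_comm, pow_mul, hζn, one_pow, one_smul]) hH'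
    rwa [hpq] at this
  have hcard : Nat.card M = ∏ i ∈ Finset.range n, Nat.card (isoComp T ζ i) := by
    have := card_eq_prod_card_ker_aeval T (fun j ↦ X - C (ζ ^ j)) n
      (by rw [hprod, map_sub, map_pow, aeval_X, hT, map_one, sub_self])
      (fun i hi ↦ by
        rw [aeval_X_sub_C_pow]
        exact (hiso i hi).le.trans (range_quasiIdem_le_range_tailProd T hi hζn hprod))
    simp only [aeval_X_sub_C_pow] at this
    exact this
  refine ⟨hiso, hcard, hcard.trans (Finset.prod_congr rfl fun i hi ↦ ?_)⟩
  rw [hiso i (Finset.mem_range.mp hi)]
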